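/- Suppose S : [0,1]² → ℝ⁴ is a strictly proper two-dimensional scoring rule satisfying the technical assumptions and the budget-constrained truthfulness property. Then there exist reports p, q₀ ∈ [0,1]² with q = ½p + ½q₀, a radius r > 0, and a budget function b(π) > 0 defined for all π ∈ ℝ² with |π| < r, such that for every such π, setting q₀(π) = q₀ − π and p(π) = p + π, the report q is the maximizer of p̂(π)·S(·) over {q' : nb(q₀(π), q') ≤ b(π)}, and S_TL(q₀(π)) − S_TL(q) = b(π) > max{ S_TR(q₀(π)) − S_TR(q), S_BL(q₀(π)) − S_BL(q), S_BR(q₀(π)) − S_BR(q) }. -/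

import Mathlib

open scoped BigOperators

noncomputable section

/-- The space of reports `[0,1]²`: a pair `(q_T, q_L)` of probabilities for the independent
events `Top` and `Left`. -/
def box2 : Set (ℝ × ℝ) := Set.Icc (0:ℝ) 1 ×ˢ Set.Icc (0:ℝ) 1

/-- The open square `(0,1)²`. -/
def openBox2 : Set (ℝ × ℝ) := Set.Ioo (0:ℝ) 1 ×ˢ Set.Ioo (0:ℝ) 1

/-- The implied product distribution `q̂ = (q_T q_L, q_T(1−q_L), (1−q_T)q_L, (1−q_T)(1−q_L))`
over the four outcomes `(TL, TR, BL, BR)` (identified with `0, 1, 2, 3`). -/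
def hat2 (q : ℝ × ℝ) : Fin 4 → ℝ :=
  ![q.1 * q.2, q.1 * (1 - q.2), (1 - q.1) * q.2, (1 - q.1) * (1 - q.2)]

/-- Dot product of two vectors in `ℝ⁴`. -/
def dot4 (p s : Fin 4 → ℝ) : ℝ := ∑ i, p i * s i

/-- A two-dimensional scoring rule `S : [0,1]² → ℝ⁴` is strictly proper if for all `p ≠ q` in
`[0,1]²`, `p̂·S(p) > p̂·S(q)`. -/
def StrictlyProper2D (S : ℝ × ℝ → Fin 4 → ℝ) : Prop :=
  ∀ p ∈ box2, ∀ q ∈ box2, p ≠ q → dot4 (hat2 p) (S q) < dot4 (hat2 p) (S p)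

/-- Each component `S_o` is quasiconcave: `S_o(½p + ½q) ≥ min (S_o p) (S_o q)`, with equality
only if `S_o p = S_o q`. -/
def QuasiConcave2D (S : ℝ × ℝ → Fin 4 → ℝ) : Prop :=
  ∀ o : Fin 4, ∀ p ∈ box2, ∀ q ∈ box2,
    min (S p o) (S q o) ≤ S ((1/2 : ℝ) • p + (1/2 : ℝ) • q) o ∧
    (S ((1/2 : ℝ) • p + (1/2 : ℝ) • q) o = min (S p o) (S q o) → S p o = S q o)

/-- The technical assumptions: continuity on `[0,1]²`, differentiability on `(0,1)²`, and
componentwise quasiconcavity. -/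
def Tech2D (S : ℝ × ℝ → Fin 4 → ℝ) : Prop :=
  ContinuousOn S box2 ∧ DifferentiableOn ℝ S openBox2 ∧ QuasiConcave2D S

/-- The natural budget required to move from `q₀` to `q`: `max_o (S_o(q₀) − S_o(q))` over the
four outcomes. -/
def nb4 (S : ℝ × ℝ → Fin 4 → ℝ) (q₀ q : ℝ × ℝ) : ℝ :=
  max (max (S q₀ 0 - S q 0) (S q₀ 1 - S q 1)) (max (S q₀ 2 - S q 2) (S q₀ 3 - S q 3))

/-- The budget-constrained truthfulness property: for every belief `p`, reference point `q₀`
and budget `b > 0`, the expected score `p̂·S(q)` over feasible reports (`q ∈ [0,1]²` with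
`nb(q₀,q) ≤ b`) is uniquely maximized at `q* = α p + (1−α) q₀`, where `α` is the greatest
element of `{α ∈ [0,1] : nb(q₀, α p + (1−α) q₀) ≤ b}`. -/
def BCT2D (S : ℝ × ℝ → Fin 4 → ℝ) : Prop :=
  ∀ p ∈ box2, ∀ q₀ ∈ box2, ∀ b : ℝ, 0 < b →
    ∃ α : ℝ,
      IsGreatest {a : ℝ | a ∈ Set.Icc (0:ℝ) 1 ∧
        nb4 S q₀ (a • p + (1 - a) • q₀) ≤ b} α ∧
      ∀ q ∈ box2, nb4 S q₀ q ≤ b → q ≠ α • p + (1 - α) • q₀ →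
        dot4 (hat2 p) (S q) < dot4 (hat2 p) (S (α • p + (1 - α) • q₀))

/-- The point at parameter `t` on the ray of slope `m` from the centre of the square. -/
def rayPt (t m : ℝ) : ℝ × ℝ := (1/2 + t, 1/2 + m * t)

lemma rayPt_mem {t m : ℝ} (ht : 0 ≤ t) (ht' : t ≤ 1/2) (hm : 1/4 ≤ m) (hm' : m ≤ 1/2) :
    rayPt t m ∈ box2 := by
  refine ⟨⟨?_, ?_⟩, ⟨?_, ?_⟩⟩ <;> simp only [rayPt] <;> nlinarith

lemma rayPt_comb (a t m : ℝ) :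
    a • rayPt t m + (1 - a) • rayPt 0 m = rayPt (a * t) m := by
  ext <;> simp [rayPt] <;> ring

lemma rayPt_zero (m : ℝ) : rayPt 0 m = (1/2, 1/2) := by
  simp [rayPt]

lemma dot4_expand (p : ℝ × ℝ) (s : Fin 4 → ℝ) : dot4 (hat2 p) s =
    p.1 * p.2 * s 0 + p.1 * (1 - p.2) * s 1 + (1 - p.1) * p.2 * s 2
      + (1 - p.1) * (1 - p.2) * s 3 := by
  simp [dot4, hat2, Fin.sum_univ_four]

/-- The natural budget needed to leave the centre is positive. -/
lemma nb4_pos (S : ℝ × ℝ → Fin 4 → ℝ) (hSP : StrictlyProper2D S) (q : ℝ × ℝ)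
    (hq : q ∈ box2) (hne : ((1/2 : ℝ), (1/2 : ℝ)) ≠ q) : 0 < nb4 S (1/2, 1/2) q := by
  have h := hSP (1/2, 1/2) (by constructor <;> constructor <;> norm_num) q hq hne
  rw [dot4_expand, dot4_expand] at h
  by_contra hc
  simp only [nb4, not_lt, max_le_iff] at hc
  obtain ⟨⟨h0, h1⟩, h2, h3⟩ := hc
  norm_num at h h0 h1 h2 h3
  linarith

/-- The linear-algebra estimate. -/
lemma estimate (A B C D m m' σ ρ : ℝ) (hm : 1/4 ≤ m) (hm1 : m ≤ 1/2)
    (hd : |m' - m| ≤ 1/2500) (hσ : σ = 1 ∨ σ = -1) (hρ : ρ = 1 ∨ ρ = -1)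
    (h : ∀ t, 1/4 ≤ t → t ≤ 1/2 → A + t * (B + m * C) + m * t^2 * D < 0)
    (h' : ∀ t, 1/4 ≤ t → t ≤ 1/2 → 0 < A + t * (B + m' * C) + m' * t^2 * D)
    (ho : A + σ * B / 2 + ρ * C / 2 + σ * ρ * D / 4 = 0) : False := by
  obtain ⟨ε, hε⟩ : ∃ ε, ε = |m' - m| * (|C| + |D|) := ⟨_, rfl⟩
  have key : ∀ t, 1/4 ≤ t → t ≤ 1/2 → |A + t * (B + m * C) + m * t^2 * D| ≤ ε := by
    intro t h1 h2
    have e1 := h t h1 h2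
    have e2 := h' t h1 h2
    have e3 : (m' - m) * (t * C + t^2 * D) ≤ |m' - m| * (|C| + |D|) := by
      refine (le_abs_self _).trans ?_
      rw [abs_mul]
      refine mul_le_mul_of_nonneg_left ?_ (abs_nonneg _)
      refine (abs_add_le _ _).trans ?_
      rw [abs_mul, abs_mul, abs_of_nonneg (by linarith : 0 ≤ t), abs_of_nonneg (sq_nonneg t)]
      have : t^2 ≤ 1 := by nlinarith
      nlinarith [abs_nonneg C, abs_nonneg D]
    rw [abs_of_neg e1]
    nlinarith
  have k1 := abs_le.1 (key (1/4) (by norm_num) (by norm_num))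
  have k2 := abs_le.1 (key (3/8) (by norm_num) (by norm_num))
  have k3 := abs_le.1 (key (1/2) (by norm_num) (by norm_num))
  obtain ⟨E, hE⟩ : ∃ E, E = m * D := ⟨_, rfl⟩
  obtain ⟨G, hG⟩ : ∃ G, G = B + m * C := ⟨_, rfl⟩
  rw [← hG] at k1 k2 k3
  have r : ∀ t : ℝ, m * t^2 * D = t^2 * E := by intro t; rw [hE]; ring
  rw [r] at k1 k2 k3
  norm_num at k1 k2 k3
  have hE1 : |E| ≤ 128 * ε := abs_le.2 ⟨by linarith, by linarith⟩
  have hG1 : |G| ≤ 104 * ε := by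
    have := abs_le.1 hE1
    exact abs_le.2 ⟨by linarith, by linarith⟩
  have hA1 : |A| ≤ 85 * ε := by
    have := abs_le.1 hE1
    have := abs_le.1 hG1
    exact abs_le.2 ⟨by linarith, by linarith⟩
  have hD1 : |D| ≤ 512 * ε := by
    rw [hE, abs_mul, abs_of_nonneg (by linarith : 0 ≤ m)] at hE1
    nlinarith [abs_nonneg D]
  have hC1 : |C| ≤ 1060 * ε := by
    have a1 := abs_le.1 hG1
    have a2 := abs_le.1 hA1
    have a3 := abs_le.1 hD1
    have hB : B = G - m * C := by rw [hG]; ring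
    have b1 : (1 - m) * |C| ≤ 530 * ε ∨ (1 + m) * |C| ≤ 530 * ε := by
      rcases hσ with rfl | rfl <;> rcases hρ with rfl | rfl
      · left
        rw [← abs_of_nonneg (by linarith : 0 ≤ 1 - m), ← abs_mul]
        exact abs_le.2 ⟨by linarith, by linarith⟩
      · right
        rw [← abs_of_nonneg (by linarith : 0 ≤ 1 + m), ← abs_mul]
        exact abs_le.2 ⟨by linarith, by linarith⟩
      · right
        rw [← abs_of_nonneg (by linarith : 0 ≤ 1 + m), ← abs_mul]
        exact abs_le.2 ⟨by linarith, by linarith⟩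
      · left
        rw [← abs_of_nonneg (by linarith : 0 ≤ 1 - m), ← abs_mul]
        exact abs_le.2 ⟨by linarith, by linarith⟩
    have c0 := abs_nonneg C
    have c1 : 1/4 * |C| ≤ m * |C| := mul_le_mul_of_nonneg_right hm c0
    have c2 : m * |C| ≤ 1/2 * |C| := mul_le_mul_of_nonneg_right hm1 c0
    rcases b1 with b1 | b1 <;> linarith
  have hε1 : ε ≤ 1/2500 * (|C| + |D|) := by
    rw [hε]
    exact mul_le_mul_of_nonneg_right hd (by positivity)
  have hε0 : ε ≤ 0 := by linarith
  have a2 := abs_le.1 hA1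
  have a1 := abs_le.1 hG1
  have a3 := abs_le.1 hE1
  have e := h (1/4) (by norm_num) (by norm_num)
  rw [← hG, r] at e
  norm_num at e
  linarith

/-- For each slope, the exit point of the feasible set is optimal for all far beliefs on the ray. -/
lemma exit_point (S : ℝ × ℝ → Fin 4 → ℝ) (hcont : ContinuousOn S box2) (hBCT : BCT2D S)
    (b : ℝ) (hb : 0 < b)
    (hfar : ∀ t m : ℝ, 1/4 ≤ t → t ≤ 1/2 → 1/4 ≤ m → m ≤ 1/2 →
      b < nb4 S (1/2, 1/2) (rayPt t m))
    (m : ℝ) (hm : 1/4 ≤ m) (hm1 : m ≤ 1/2) :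
    ∃ τ : ℝ, 0 < τ ∧ τ ≤ 1/4 ∧ nb4 S (1/2, 1/2) (rayPt τ m) = b ∧
      ∀ t, 1/4 ≤ t → t ≤ 1/2 → ∀ q ∈ box2, nb4 S (1/2, 1/2) q ≤ b → q ≠ rayPt τ m →
        dot4 (hat2 (rayPt t m)) (S q) < dot4 (hat2 (rayPt t m)) (S (rayPt τ m)) := by
  have hc : ((1/2 : ℝ), (1/2 : ℝ)) ∈ box2 := by constructor <;> constructor <;> norm_num
  have hbct : ∀ t, 1/4 ≤ t → t ≤ 1/2 → ∃ s, 0 ≤ s ∧ s ≤ t ∧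
      nb4 S (1/2, 1/2) (rayPt s m) ≤ b ∧
      (∀ s', 0 ≤ s' → s' ≤ t → nb4 S (1/2, 1/2) (rayPt s' m) ≤ b → s' ≤ s) ∧
      ∀ q ∈ box2, nb4 S (1/2, 1/2) q ≤ b → q ≠ rayPt s m →
        dot4 (hat2 (rayPt t m)) (S q) < dot4 (hat2 (rayPt t m)) (S (rayPt s m)) := by
    intro t h1 h2
    have ht : 0 < t := by linarith
    obtain ⟨α, ⟨⟨hα, hα2⟩, hα3⟩, hopt⟩ :=
      hBCT (rayPt t m) (rayPt_mem ht.le h2 hm hm1) (1/2, 1/2) hc b hb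
    rw [← rayPt_zero m, rayPt_comb, rayPt_zero] at hα2 hopt
    refine ⟨α * t, mul_nonneg hα.1 ht.le, by nlinarith [hα.2], hα2, ?_, hopt⟩
    intro s' g1 g2 g3
    have : s' / t ≤ α := by
      apply hα3
      refine ⟨⟨by positivity, (div_le_one ht).2 g2⟩, ?_⟩
      rw [← rayPt_zero m, rayPt_comb, rayPt_zero, div_mul_cancel₀ _ ht.ne']
      exact g3
    exact (div_le_iff₀ ht).1 this
  obtain ⟨τ, h0, hτ, hnb, hgr, -⟩ := hbct (1/2) (by norm_num) (by norm_num)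
  have hτ4 : τ < 1/4 := by
    by_contra hcon
    have := hfar τ m (not_lt.1 hcon) hτ hm hm1
    linarith
  have hcg : ContinuousOn (fun t => nb4 S (1/2, 1/2) (rayPt t m)) (Set.Icc τ (1/4)) := by
    have hS : ContinuousOn (fun t => S (rayPt t m)) (Set.Icc τ (1/4)) := by
      apply hcont.comp
      · unfold rayPt; fun_prop
      · intro t ht
        exact rayPt_mem (by linarith [ht.1]) (by linarith [ht.2]) hm hm1
    have hSo : ∀ o, ContinuousOn (fun t => S (rayPt t m) o) (Set.Icc τ (1/4)) :=
      fun o => continuousOn_pi.1 hS o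
    unfold nb4
    exact ((continuousOn_const.sub (hSo 0)).sup (continuousOn_const.sub (hSo 1))).sup
      ((continuousOn_const.sub (hSo 2)).sup (continuousOn_const.sub (hSo 3)))
  have heq : nb4 S (1/2, 1/2) (rayPt τ m) = b := by
    have := intermediate_value_Icc hτ4.le hcg
      ⟨hnb, (hfar (1/4) m le_rfl (by norm_num) hm hm1).le⟩
    obtain ⟨s, hs, hsb⟩ := this
    have hsτ := hgr s (by linarith [hs.1]) (by linarith [hs.2]) hsb.le
    have : s = τ := le_antisymm hsτ hs.1
    rw [← this]; exact hsb
  refine ⟨τ, ?_, hτ4.le, heq, ?_⟩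
  · rcases h0.lt_or_eq with h | h
    · exact h
    · rw [← h, rayPt_zero] at heq
      simp [nb4] at heq
      linarith
  · intro t h1 h2
    obtain ⟨s, s0, s1, s2, s3, s4⟩ := hbct t h1 h2
    have e : s = τ := le_antisymm (hgr s s0 (by linarith) s2) (s3 τ h0 (by linarith) hnb)
    rw [e] at s4
    exact s4

lemma nb4_attained (S : ℝ × ℝ → Fin 4 → ℝ) (q₀ q : ℝ × ℝ) :
    ∃ o : Fin 4, S q₀ o - S q o = nb4 S q₀ q := by
  unfold nb4
  rcases max_choice (max (S q₀ 0 - S q 0) (S q₀ 1 - S q 1))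
    (max (S q₀ 2 - S q 2) (S q₀ 3 - S q 3)) with h | h <;> rw [h]
  · rcases max_choice (S q₀ 0 - S q 0) (S q₀ 1 - S q 1) with h | h <;> rw [h] <;> exact ⟨_, rfl⟩
  · rcases max_choice (S q₀ 2 - S q 2) (S q₀ 3 - S q 3) with h | h <;> rw [h] <;> exact ⟨_, rfl⟩

/-- No strictly proper continuous rule has the budget-constrained truthfulness property. -/
lemma impossible (S : ℝ × ℝ → Fin 4 → ℝ)
    (hSP : StrictlyProper2D S) (hcont : ContinuousOn S box2) (hBCT : BCT2D S) : False := by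
  obtain ⟨b, hb, hfar⟩ : ∃ b : ℝ, 0 < b ∧
      ∀ t m : ℝ, 1/4 ≤ t → t ≤ 1/2 → 1/4 ≤ m → m ≤ 1/2 →
      b < nb4 S (1/2, 1/2) (rayPt t m) := by
    have hK : IsCompact (Set.Icc (1/4 : ℝ) (1/2) ×ˢ Set.Icc (1/4 : ℝ) (1/2)) :=
      isCompact_Icc.prod isCompact_Icc
    have hS : ContinuousOn (fun z : ℝ × ℝ => S (rayPt z.1 z.2))
        (Set.Icc (1/4 : ℝ) (1/2) ×ˢ Set.Icc (1/4 : ℝ) (1/2)) := by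
      apply hcont.comp
      · unfold rayPt; fun_prop
      · rintro ⟨t, m⟩ ⟨ht, hm⟩
        exact rayPt_mem (by linarith [ht.1]) ht.2 hm.1 hm.2
    have hSo := fun o => continuousOn_pi.1 hS o
    have hg : ContinuousOn (fun z : ℝ × ℝ => nb4 S (1/2, 1/2) (rayPt z.1 z.2))
        (Set.Icc (1/4 : ℝ) (1/2) ×ˢ Set.Icc (1/4 : ℝ) (1/2)) := by
      unfold nb4
      exact ((continuousOn_const.sub (hSo 0)).sup (continuousOn_const.sub (hSo 1))).sup
        ((continuousOn_const.sub (hSo 2)).sup (continuousOn_const.sub (hSo 3)))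
    obtain ⟨⟨t₀, m₀⟩, ⟨ht, hm⟩, hmin⟩ := hK.exists_isMinOn
      ⟨(1/4, 1/4), by constructor <;> constructor <;> norm_num⟩ hg
    have hpos : 0 < nb4 S (1/2, 1/2) (rayPt t₀ m₀) := by
      apply nb4_pos S hSP _ (rayPt_mem (by linarith [ht.1]) ht.2 hm.1 hm.2)
      intro h
      have h1 := congrArg Prod.fst h
      have h2 := ht.1
      simp only [rayPt] at h1 h2
      linarith
    refine ⟨nb4 S (1/2, 1/2) (rayPt t₀ m₀) / 2, by linarith, ?_⟩
    intro t m h1 h2 h3 h4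
    have : nb4 S (1/2, 1/2) (rayPt t₀ m₀) ≤ nb4 S (1/2, 1/2) (rayPt t m) :=
      hmin (show (t, m) ∈ _ from ⟨⟨h1, h2⟩, ⟨h3, h4⟩⟩)
    linarith
  have hex : ∀ k : Fin 5, ∃ τ : ℝ, 0 < τ ∧ τ ≤ 1/4 ∧
      nb4 S (1/2, 1/2) (rayPt τ (1/4 + (k : ℝ) / 10000)) = b ∧
      ∀ t, 1/4 ≤ t → t ≤ 1/2 → ∀ q ∈ box2, nb4 S (1/2, 1/2) q ≤ b →
        q ≠ rayPt τ (1/4 + (k : ℝ) / 10000) →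
        dot4 (hat2 (rayPt t (1/4 + (k : ℝ) / 10000))) (S q) <
          dot4 (hat2 (rayPt t (1/4 + (k : ℝ) / 10000)))
            (S (rayPt τ (1/4 + (k : ℝ) / 10000))) := by
    intro k
    have h4 : (k : ℝ) ≤ 4 := by exact_mod_cast Nat.lt_succ_iff.1 k.2
    have h0 : (0 : ℝ) ≤ k := by positivity
    exact exit_point S hcont hBCT b hb hfar _ (by linarith) (by linarith)
  choose τ hτ0 hτ4 hnb hopt using hex
  have hat : ∀ k : Fin 5, ∃ o : Fin 4,
      S (1/2, 1/2) o - S (rayPt (τ k) (1/4 + (k : ℝ) / 10000)) o = b := by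
    intro k
    obtain ⟨o, ho⟩ := nb4_attained S (1/2, 1/2) (rayPt (τ k) (1/4 + (k : ℝ) / 10000))
    exact ⟨o, ho.trans (hnb k)⟩
  choose o ho using hat
  obtain ⟨k, l, hkl, hokl⟩ := Fintype.exists_ne_map_eq_of_card_lt o (by simp)
  have hk4 : (k : ℝ) ≤ 4 := by exact_mod_cast Nat.lt_succ_iff.1 k.2
  have hk0 : (0 : ℝ) ≤ k := by positivity
  have hl4 : (l : ℝ) ≤ 4 := by exact_mod_cast Nat.lt_succ_iff.1 l.2
  have hl0 : (0 : ℝ) ≤ l := by positivity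
  have hklr : (k : ℝ) ≠ l := by
    intro h
    exact hkl (Fin.ext (by exact_mod_cast h))
  have hok := ho k
  have hol := ho l
  rw [← hokl] at hol
  have hoptk := hopt k
  have hoptl := hopt l
  have hnbk := hnb k
  have hnbl := hnb l
  have hτk := hτ0 k
  have hτl := hτ0 l
  have hτk4 := hτ4 k
  have hτl4 := hτ4 l
  generalize hm : 1/4 + (k : ℝ) / 10000 = m at *
  generalize hm' : 1/4 + (l : ℝ) / 10000 = m' at *
  have hne : rayPt (τ k) m ≠ rayPt (τ l) m' := by
    intro h
    have h1 := congrArg Prod.fst h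
    have h2 := congrArg Prod.snd h
    simp only [rayPt] at h1 h2
    have h3 : τ k = τ l := by linarith
    rw [h3] at h2
    have h4 : m = m' := by
      apply mul_right_cancel₀ hτl.ne'
      linarith
    apply hklr
    linarith
  have hxk : rayPt (τ k) m ∈ box2 := rayPt_mem hτk.le (by linarith) (by linarith) (by linarith)
  have hxl : rayPt (τ l) m' ∈ box2 := rayPt_mem hτl.le (by linarith) (by linarith) (by linarith)
  have H1 := fun t h1 h2 => hoptk t h1 h2 _ hxl hnbl.le hne.symm
  have H2 := fun t h1 h2 => hoptl t h1 h2 _ hxk hnbk.le hne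
  have hΔ : S (rayPt (τ l) m') (o k) - S (rayPt (τ k) m) (o k) = 0 := by linarith
  generalize S (rayPt (τ l) m') = s' at *
  generalize S (rayPt (τ k) m) = s at *
  simp only [dot4_expand, rayPt] at H1 H2
  obtain ⟨σ, ρ, hσ, hρ, hs⟩ : ∃ σ ρ : ℝ, (σ = 1 ∨ σ = -1) ∧ (ρ = 1 ∨ ρ = -1) ∧
      ((s' 0 - s 0) + (s' 1 - s 1) + (s' 2 - s 2) + (s' 3 - s 3)) / 4
      + σ * (((s' 0 - s 0) + (s' 1 - s 1) - (s' 2 - s 2) - (s' 3 - s 3)) / 2) / 2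
      + ρ * (((s' 0 - s 0) - (s' 1 - s 1) + (s' 2 - s 2) - (s' 3 - s 3)) / 2) / 2
      + σ * ρ * ((s' 0 - s 0) - (s' 1 - s 1) - (s' 2 - s 2) + (s' 3 - s 3)) / 4 = 0 := by
    generalize o k = i at hΔ
    fin_cases i <;> simp at hΔ
    · exact ⟨1, 1, by simp, by simp, by linarith⟩
    · exact ⟨1, -1, by simp, by simp, by linarith⟩
    · exact ⟨-1, 1, by simp, by simp, by linarith⟩
    · exact ⟨-1, -1, by simp, by simp, by linarith⟩
  refine estimate _ _ _ _ m m' σ ρ (by linarith) (by linarith) ?_ hσ hρ ?_ ?_ hs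
  · rw [abs_le]; constructor <;> linarith
  · intro t h1 h2
    have := H1 t h1 h2
    ring_nf at this ⊢
    linarith
  · intro t h1 h2
    have := H2 t h1 h2
    ring_nf at this ⊢
    linarith

/-- Lemma `2dconstruction`: if `S` is a strictly proper two-dimensional scoring
rule satisfying the technical assumptions and the budget-constrained truthfulness property,
then there exist reports `p, q₀ ∈ [0,1]²` with midpoint `q = ½p + ½q₀`, a radius `r > 0`, and
a budget function `b(π) > 0` defined for all `π` with `|π| < r`, such that for every such `π`,
setting `q₀(π) = q₀ − π` and `p(π) = p + π` (both valid reports), the report `q` maximizes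
`p̂(π)·S(·)` over `{q' ∈ [0,1]² : nb(q₀(π), q') ≤ b(π)}`, and
`S_TL(q₀(π)) − S_TL(q) = b(π) > max{S_TR(q₀(π)) − S_TR(q), S_BL(q₀(π)) − S_BL(q),
S_BR(q₀(π)) − S_BR(q)}`. -/
theorem stmt8 (S : ℝ × ℝ → Fin 4 → ℝ)
    (hSP : StrictlyProper2D S) (hTech : Tech2D S) (hBCT : BCT2D S) :
    ∃ p q₀ q : ℝ × ℝ, p ∈ box2 ∧ q₀ ∈ box2 ∧
      q = (1/2 : ℝ) • p + (1/2 : ℝ) • q₀ ∧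
      ∃ r : ℝ, 0 < r ∧ ∃ bfun : ℝ × ℝ → ℝ,
        ∀ π : ℝ × ℝ, ‖π‖ < r →
          0 < bfun π ∧ q₀ - π ∈ box2 ∧ p + π ∈ box2 ∧
          (∀ q' ∈ box2, nb4 S (q₀ - π) q' ≤ bfun π →
            dot4 (hat2 (p + π)) (S q') ≤ dot4 (hat2 (p + π)) (S q)) ∧
          S (q₀ - π) 0 - S q 0 = bfun π ∧
          S (q₀ - π) 1 - S q 1 < bfun π ∧
          S (q₀ - π) 2 - S q 2 < bfun π ∧
          S (q₀ - π) 3 - S q 3 < bfun π := by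
  exact (impossible S hSP hTech.1 hBCT).elim
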